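/- Let γ: ℝ/L → ℝ³ be a minimal inspection curve. Then there exists an open set U ⊂ ℝ/L such that at every regular point t ∈ U the tangent line of γ at t does not pass through the origin o; furthermore, if U ≠ ℝ/L, then the complement (ℝ/L) \ U is a disjoint union of finitely many closed intervals, each of which is mapped by γ into a line segment that passes through o and has its endpoints on ∂conv(γ). -/

import Mathlib

open Real Set MeasureTheory ENNReal

noncomputable section


noncomputable section

abbrev E3 := EuclideanSpace ℝ (Fin 3)

/-- The lift of a curve `γ : ℝ/L → ℝ³` to `ℝ`, via the quotient map `ℝ → ℝ/L`. -/
def liftCurve (L : ℝ) (γ : AddCircle L → E3) : ℝ → E3 := fun s => γ s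

/-- An inspection curve is a closed rectifiable curve `γ : ℝ/L → ℝ³`, parameterized with
constant unit speed (`1`-Lipschitz with total variation `L` over one period), whose convex
hull contains the unit sphere centered at the origin. -/
def IsInspectionCurve (L : ℝ) (γ : AddCircle L → E3) : Prop :=
  0 < L ∧ Continuous γ ∧ LipschitzWith 1 (liftCurve L γ) ∧
    eVariationOn (liftCurve L γ) (Set.Icc 0 L) = ENNReal.ofReal L ∧
    Metric.sphere (0 : E3) 1 ⊆ convexHull ℝ (Set.range γ)

/-- A minimal inspection curve is an inspection curve of minimal length. -/
def IsMinInspectionCurve (L : ℝ) (γ : AddCircle L → E3) : Prop :=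
  IsInspectionCurve L γ ∧
    ∀ (L' : ℝ) (γ' : AddCircle L' → E3), IsInspectionCurve L' γ' → L ≤ L'

/-- In a finite-dimensional space, the convex hull of a compact set is compact. -/
theorem isCompact_convexHull_of_isCompact {E : Type*} [NormedAddCommGroup E] [NormedSpace ℝ E]
    [FiniteDimensional ℝ E] {s : Set E} (hs : IsCompact s) : IsCompact (convexHull ℝ s) := by
  have key : convexHull ℝ s = ⋃ n ∈ Finset.range (Module.finrank ℝ E + 2),
      (fun p : (Fin n → ℝ) × (Fin n → E) => ∑ i, p.1 i • p.2 i) ''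
        (stdSimplex ℝ (Fin n) ×ˢ Set.univ.pi fun _ => s) := by
    ext x
    simp only [Set.mem_iUnion, Finset.mem_range]
    constructor
    · intro hx
      obtain ⟨ι, _, z, w, hz, hind, hw, hw1, rfl⟩ := eq_pos_convex_span_of_mem_convexHull hx
      have hcard : Fintype.card ι ≤ Module.finrank ℝ E + 1 :=
        (hind.card_le_finrank_succ).trans
          (Nat.succ_le_succ (Submodule.finrank_le _))
      let e := (Fintype.equivFin ι).symm
      refine ⟨Fintype.card ι, by omega, (w ∘ e, z ∘ e),
        ⟨⟨fun i => (hw _).le, ?_⟩, fun i _ => hz ⟨_, rfl⟩⟩, ?_⟩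
      · rw [← hw1]; exact e.sum_comp w
      · exact e.sum_comp fun i => w i • z i
    · rintro ⟨n, _, ⟨w, z⟩, ⟨⟨hw, hw1⟩, hz⟩, rfl⟩
      exact (convex_convexHull ℝ s).sum_mem (fun i _ => hw i) hw1
        fun i _ => subset_convexHull ℝ s (hz i (Set.mem_univ i))
  rw [key]
  refine (Finset.range _).isCompact_biUnion fun n _ => ?_
  refine ((isCompact_stdSimplex ℝ (Fin n)).prod (isCompact_univ_pi fun _ => hs)).image ?_
  fun_prop

section Curves

variable {E : Type*} [PseudoMetricSpace E] {f : ℝ → E} {a b c d : ℝ}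

theorem LipschitzOnWith.eVariationOn_Icc_le (hf : LipschitzOnWith 1 f (Icc a b)) :
    eVariationOn f (Icc a b) ≤ ENNReal.ofReal (b - a) := by
  simpa using hf.comp_eVariationOn_le (g := id) (s := Icc a b) (fun x hx => hx)

theorem LipschitzOnWith.Icc_union_Icc (h₁ : LipschitzOnWith 1 f (Icc a b))
    (h₂ : LipschitzOnWith 1 f (Icc b c)) : LipschitzOnWith 1 f (Icc a c) := by
  have key : ∀ x ∈ Icc a c, ∀ y ∈ Icc a c, x ≤ y → dist (f x) (f y) ≤ y - x := by
    intro x hx y hy hxy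
    have e : ∀ {u v}, LipschitzOnWith 1 f (Icc u v) → ∀ x ∈ Icc u v, ∀ y ∈ Icc u v, x ≤ y →
        dist (f x) (f y) ≤ y - x := by
      intro u v h x hx y hy hxy
      have := h.dist_le_mul x hx y hy
      rwa [NNReal.coe_one, one_mul, dist_comm x, Real.dist_eq, abs_of_nonneg (by linarith)] at this
    rcases le_total y b with hyb | hyb
    · exact e h₁ x ⟨hx.1, by linarith⟩ y ⟨hy.1, hyb⟩ hxy
    rcases le_total b x with hxb | hxb
    · exact e h₂ x ⟨hxb, hx.2⟩ y ⟨hyb, hy.2⟩ hxy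
    have h1 := e h₁ x ⟨hx.1, hxb⟩ b ⟨hx.1.trans hxb, le_rfl⟩ hxb
    have h2 := e h₂ b ⟨le_rfl, hyb.trans hy.2⟩ y ⟨hyb, hy.2⟩ hyb
    linarith [dist_triangle (f x) (f b) (f y)]
  refine LipschitzOnWith.of_dist_le_mul fun x hx y hy => ?_
  rw [NNReal.coe_one, one_mul]
  rcases le_total x y with h | h
  · rw [dist_comm x, Real.dist_eq, abs_of_nonneg (by linarith)]; exact key x hx y hy h
  · rw [Real.dist_eq, abs_of_nonneg (by linarith), dist_comm]; exact key y hy x hx h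

theorem eVariationOn_Icc_add_Icc (hab : a ≤ b) (hbc : b ≤ c) :
    eVariationOn f (Icc a b) + eVariationOn f (Icc b c) = eVariationOn f (Icc a c) := by
  simpa using eVariationOn.Icc_add_Icc f (s := univ) hab hbc (mem_univ b)

theorem eVariationOn_Icc_append (hab : a ≤ b) (hbc : b ≤ c)
    (h₁ : eVariationOn f (Icc a b) = ENNReal.ofReal (b - a))
    (h₂ : eVariationOn f (Icc b c) = ENNReal.ofReal (c - b)) :
    eVariationOn f (Icc a c) = ENNReal.ofReal (c - a) := by
  rw [← eVariationOn_Icc_add_Icc hab hbc, h₁, h₂, ← ENNReal.ofReal_add (by linarith) (by linarith)]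
  congr 1; ring

theorem eVariationOn_comp_const_add (t : ℝ) :
    eVariationOn (fun s => f (t + s)) (Icc a b) = eVariationOn f (Icc (t + a) (t + b)) := by
  have := eVariationOn.comp_eq_of_monotoneOn f (t := Icc a b) (fun s => t + s)
    (fun x _ y _ h => by simpa using h)
  rwa [Set.image_const_add_Icc] at this

/-- A `1`-Lipschitz curve of full length on an interval has full length on subintervals. -/
theorem LipschitzWith.eVariationOn_Icc_of_subset (hf : LipschitzWith 1 f)
    (h : eVariationOn f (Icc a d) = ENNReal.ofReal (d - a)) (hab : a ≤ b) (hbc : b ≤ c)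
    (hcd : c ≤ d) : eVariationOn f (Icc b c) = ENNReal.ofReal (c - b) := by
  refine le_antisymm (hf.lipschitzOnWith).eVariationOn_Icc_le ?_
  have h1 := (hf.lipschitzOnWith (s := Icc a b)).eVariationOn_Icc_le
  have h2 := (hf.lipschitzOnWith (s := Icc c d)).eVariationOn_Icc_le
  rw [← eVariationOn_Icc_add_Icc hab (hbc.trans hcd), ← eVariationOn_Icc_add_Icc hbc hcd] at h
  have h3 : ENNReal.ofReal (d - a) =
      ENNReal.ofReal (b - a) + (ENNReal.ofReal (c - b) + ENNReal.ofReal (d - c)) := by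
    rw [← ENNReal.ofReal_add (by linarith) (by linarith),
      ← ENNReal.ofReal_add (by linarith) (by linarith)]
    congr 1; ring
  by_contra hlt
  push Not at hlt
  have : eVariationOn f (Icc b c) + eVariationOn f (Icc c d) <
      ENNReal.ofReal (c - b) + ENNReal.ofReal (d - c) :=
    ENNReal.add_lt_add_of_lt_of_le (ne_top_of_le_ne_top ENNReal.ofReal_ne_top h2) hlt h2
  have := ENNReal.add_lt_add_of_le_of_lt
    (ne_top_of_le_ne_top ENNReal.ofReal_ne_top h1) h1 this
  rw [h, h3] at this
  exact lt_irrefl _ this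

/-- A periodic `1`-Lipschitz curve of full length on a period has full length on every interval. -/
theorem LipschitzWith.eVariationOn_Icc_of_periodic {L : ℝ} (hL : 0 < L) (hf : LipschitzWith 1 f)
    (hper : Function.Periodic f L) (h : eVariationOn f (Icc 0 L) = ENNReal.ofReal L)
    (hab : a ≤ b) : eVariationOn f (Icc a b) = ENNReal.ofReal (b - a) := by
  have h1 : ∀ n : ℤ, eVariationOn f (Icc (n * L) (n * L + L)) = ENNReal.ofReal L := by
    intro n
    have : (fun s => f (n * L + s)) = f := by
      funext s
      have := (hper.int_mul n) s
      rwa [add_comm] at this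
    have h2 := eVariationOn_comp_const_add (f := f) (a := 0) (b := L) (n * L)
    rw [this, h, add_zero] at h2
    exact h2.symm
  have h2 : ∀ (m : ℤ) (n : ℕ),
      eVariationOn f (Icc (m * L) (m * L + n * L)) = ENNReal.ofReal (m * L + n * L - m * L) := by
    intro m n
    induction n with
    | zero => simp
    | succ n ih =>
      have h3 := h1 (m + n)
      push_cast at h3 ⊢
      have e : (m : ℝ) * L + (n + 1) * L = (m + n) * L + L := by ring
      rw [e]
      rw [← add_mul] at ih
      refine eVariationOn_Icc_append (b := (m + n) * L) ?_ (by linarith) ih ?_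
      · have : (0 : ℝ) ≤ n * L := by positivity
        linarith
      · rw [h3]; congr 1; ring
  obtain ⟨n, hn⟩ := exists_nat_ge ((b - ⌊a / L⌋ * L) / L)
  refine hf.eVariationOn_Icc_of_subset (h2 ⌊a / L⌋ n) ?_ hab ?_
  · rw [← le_div_iff₀ hL]; exact Int.floor_le _
  · rw [div_le_iff₀ hL] at hn; linarith

/-- A periodic curve that is `1`-Lipschitz on a period is `1`-Lipschitz. -/
theorem Function.Periodic.lipschitzWith_one {T : ℝ} (hT : 0 < T) (hper : Function.Periodic f T)
    (h : LipschitzOnWith 1 f (Icc 0 T)) : LipschitzWith 1 f := by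
  have e : ∀ n : ℤ, ∀ x ∈ Icc (n * T) (n * T + T), ∀ y ∈ Icc (n * T) (n * T + T), x ≤ y →
      dist (f x) (f y) ≤ y - x := by
    intro n x hx y hy hxy
    have := h.dist_le_mul (x - n * T) ⟨by linarith [hx.1], by linarith [hx.2]⟩ (y - n * T)
      ⟨by linarith [hy.1], by linarith [hy.2]⟩
    rwa [NNReal.coe_one, one_mul, hper.sub_int_mul_eq, hper.sub_int_mul_eq, dist_sub_right,
      dist_comm x, Real.dist_eq, abs_of_nonneg (by linarith)] at this
  have key : ∀ x y, x ≤ y → dist (f x) (f y) ≤ y - x := by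
    intro x y hxy
    set m := ⌊x / T⌋
    set n := ⌊y / T⌋
    have hm : m * T ≤ x := by rw [← le_div_iff₀ hT]; exact Int.floor_le _
    have hm' : x ≤ m * T + T := by
      have := (Int.lt_floor_add_one (x / T)).le
      rw [div_le_iff₀ hT] at this; linarith
    have hn : n * T ≤ y := by rw [← le_div_iff₀ hT]; exact Int.floor_le _
    have hn' : y ≤ n * T + T := by
      have := (Int.lt_floor_add_one (y / T)).le
      rw [div_le_iff₀ hT] at this; linarith
    have hmn : m ≤ n := Int.floor_mono (by gcongr)
    rcases hmn.eq_or_lt with hmn | hmn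
    · rw [← hmn] at hn hn'
      exact e m x ⟨hm, hm'⟩ y ⟨hn, hn'⟩ hxy
    · have h1 := e m x ⟨hm, hm'⟩ (m * T + T) ⟨by linarith, le_rfl⟩ hm'
      have h2 := e n (n * T) ⟨le_rfl, by linarith⟩ y ⟨hn, hn'⟩ hn
      have h3 : f (m * T + T) = f (n * T) := by
        rw [hper, hper.int_mul_eq, hper.int_mul_eq]
      have h4 : (m : ℝ) + 1 ≤ n := by exact_mod_cast hmn
      have h5 : ((m : ℝ) + 1) * T ≤ n * T := by gcongr
      rw [h3] at h1
      linarith [dist_triangle (f x) (f (n * T)) (f y)]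
  refine LipschitzWith.of_dist_le_mul fun x y => ?_
  rw [NNReal.coe_one, one_mul]
  rcases le_total x y with h | h
  · rw [dist_comm x, Real.dist_eq, abs_of_nonneg (by linarith)]; exact key x y h
  · rw [Real.dist_eq, abs_of_nonneg (by linarith), dist_comm]; exact key y x h

end Curves

theorem periodic_liftCurve (L : ℝ) (γ : AddCircle L → E3) :
    Function.Periodic (liftCurve L γ) L := fun s => by
  simp [liftCurve]

/-- A closed unit-speed curve on `[0, T]` whose hull contains the unit sphere gives rise to an
inspection curve of length `T`. -/
theorem exists_isInspectionCurve {T : ℝ} (hT : 0 < T) {g : ℝ → E3}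
    (hg : LipschitzOnWith 1 g (Icc 0 T)) (h0 : g 0 = g T)
    (hvar : eVariationOn g (Icc 0 T) = ENNReal.ofReal T)
    (hS : Metric.sphere (0 : E3) 1 ⊆ convexHull ℝ (g '' Icc 0 T)) :
    ∃ γ : AddCircle T → E3, IsInspectionCurve T γ := by
  have : Fact (0 < T) := ⟨hT⟩
  have hlift : EqOn (liftCurve T (AddCircle.liftIco T 0 g)) g (Icc 0 T) := by
    intro x hx
    rcases hx.2.eq_or_lt with rfl | hlt
    · rw [← h0, (periodic_liftCurve x _).eq]
      exact AddCircle.liftIco_zero_coe_apply ⟨le_rfl, hT⟩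
    · exact AddCircle.liftIco_zero_coe_apply ⟨hx.1, hlt⟩
  refine ⟨AddCircle.liftIco T 0 g, hT, AddCircle.liftIco_zero_continuous h0 hg.continuousOn, ?_,
    ?_, ?_⟩
  · exact (periodic_liftCurve T _).lipschitzWith_one hT fun x hx y hy => by
      rw [hlift hx, hlift hy]; exact hg hx hy
  · rw [eVariationOn.eq_of_eqOn hlift, hvar]
  · refine hS.trans (convexHull_mono ?_)
    rintro _ ⟨x, hx, rfl⟩
    exact ⟨x, hlift hx⟩

/-- In a minimal inspection curve, an arc that is not needed for the hull to contain the sphere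
is no longer than its chord. -/
theorem IsMinInspectionCurve.sub_le_dist {L : ℝ} {γ : AddCircle L → E3}
    (hγ : IsMinInspectionCurve L γ) {c d : ℝ} (hdc : d < c + L)
    (hS : Metric.sphere (0 : E3) 1 ⊆ convexHull ℝ (liftCurve L γ '' Icc d (c + L))) :
    d - c ≤ dist (liftCurve L γ c) (liftCurve L γ d) := by
  obtain ⟨⟨hL, -, hlip, hvar, -⟩, hmin⟩ := hγ
  have hper := periodic_liftCurve L γ
  set f := liftCurve L γ
  set D := dist (f c) (f d) with hD
  set ℓ := c + L - d with hℓ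
  have hℓ0 : 0 < ℓ := by linarith
  have hD0 : 0 ≤ D := dist_nonneg
  let g : ℝ → E3 := fun s => if s ≤ ℓ then f (d + s) else f c + ((s - ℓ) / D) • (f d - f c)
  have hg1 : EqOn g (fun s => f (d + s)) (Icc 0 ℓ) := fun s hs => if_pos hs.2
  have hg2 : EqOn g (fun s => f c + ((s - ℓ) / D) • (f d - f c)) (Icc ℓ (ℓ + D)) := by
    intro s hs
    rcases hs.1.eq_or_lt with rfl | h
    · have : d + ℓ = c + L := by rw [hℓ]; ring
      simp [g, this, hper c]
    · exact if_neg (not_le.2 h)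
  have hgT : g (ℓ + D) = f d := by
    rw [hg2 ⟨by linarith, le_rfl⟩]
    rcases hD0.eq_or_lt with h | h
    · have : f c = f d := dist_eq_zero.1 h.symm
      simp [this]
    · simp [h.ne']
  have hlip1 : LipschitzOnWith 1 g (Icc 0 ℓ) := by
    refine LipschitzOnWith.of_dist_le_mul fun x hx y hy => ?_
    rw [hg1 hx, hg1 hy]
    simpa using hlip.dist_le_mul (d + x) (d + y)
  have hlip2 : LipschitzOnWith 1 g (Icc ℓ (ℓ + D)) := by
    refine LipschitzOnWith.of_dist_le_mul fun x hx y hy => ?_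
    rw [hg2 hx, hg2 hy]
    simp only [dist_add_left, NNReal.coe_one, one_mul]
    rw [dist_eq_norm, ← sub_smul, norm_smul, ← dist_eq_norm (f d), dist_comm (f d), ← hD,
      ← sub_div, norm_div, Real.norm_of_nonneg hD0, Real.dist_eq, Real.norm_eq_abs,
      sub_sub_sub_cancel_right]
    rcases hD0.eq_or_lt with h | h
    · simp [← h]
    · rw [div_mul_cancel₀ _ h.ne']
  have hvar1 : eVariationOn g (Icc 0 ℓ) = ENNReal.ofReal (ℓ - 0) := by
    rw [eVariationOn.eq_of_eqOn hg1, eVariationOn_comp_const_add,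
      hlip.eVariationOn_Icc_of_periodic hL hper hvar (by linarith)]
    congr 1; ring
  have hvar2 : eVariationOn g (Icc ℓ (ℓ + D)) = ENNReal.ofReal (ℓ + D - ℓ) := by
    refine le_antisymm hlip2.eVariationOn_Icc_le ?_
    have := eVariationOn.edist_le g (s := Icc ℓ (ℓ + D)) (x := ℓ) (y := ℓ + D)
      ⟨le_rfl, by linarith⟩ ⟨by linarith, le_rfl⟩
    rw [hgT, hg2 ⟨le_rfl, by linarith⟩, edist_dist] at this
    simpa [← hD] using this
  obtain ⟨γ', h'⟩ := exists_isInspectionCurve (T := ℓ + D) (by linarith) (g := g)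
    (hlip1.Icc_union_Icc hlip2) (by rw [hgT, hg1 ⟨le_rfl, hℓ0.le⟩]; simp)
    (by simpa using eVariationOn_Icc_append hℓ0.le (by linarith) hvar1 hvar2)
    (hS.trans (convexHull_mono (by
      rintro _ ⟨s, hs, rfl⟩
      refine ⟨s - d, ⟨by linarith [hs.1], by linarith [hs.2]⟩, ?_⟩
      rw [hg1 ⟨by linarith [hs.1], by linarith [hs.2]⟩]
      simp)))
  have := hmin _ γ' h'
  linarith

theorem range_liftCurve (L : ℝ) (γ : AddCircle L → E3) : range (liftCurve L γ) = range γ := by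
  have : liftCurve L γ = γ ∘ (QuotientAddGroup.mk : ℝ → AddCircle L) := rfl
  rw [this, (QuotientAddGroup.mk_surjective).range_comp]

section Hull

variable {L : ℝ} {γ : AddCircle L → E3}

theorem IsInspectionCurve.isCompact_hull (hγ : IsInspectionCurve L γ) :
    IsCompact (convexHull ℝ (range γ)) :=
  have : Fact (0 < L) := ⟨hγ.1⟩
  isCompact_convexHull_of_isCompact (isCompact_range hγ.2.1)

theorem liftCurve_mem_hull (t : ℝ) : liftCurve L γ t ∈ convexHull ℝ (range γ) :=
  subset_convexHull ℝ _ (mem_range_self _)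

theorem IsInspectionCurve.ball_subset_interior_hull (hγ : IsInspectionCurve L γ) :
    Metric.ball (0 : E3) 1 ⊆ interior (convexHull ℝ (range γ)) := by
  refine interior_maximal (Metric.ball_subset_closedBall.trans ?_) Metric.isOpen_ball
  rw [← convexHull_sphere_eq_closedBall (0 : E3) zero_le_one]
  exact convexHull_min hγ.2.2.2.2 (convex_convexHull ℝ _)

theorem IsInspectionCurve.zero_mem_interior_hull (hγ : IsInspectionCurve L γ) :
    (0 : E3) ∈ interior (convexHull ℝ (range γ)) :=
  hγ.ball_subset_interior_hull (Metric.mem_ball_self one_pos)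

theorem mem_frontier_hull_iff {t : ℝ} :
    liftCurve L γ t ∈ frontier (convexHull ℝ (range γ)) ↔
      liftCurve L γ t ∉ interior (convexHull ℝ (range γ)) :=
  ⟨fun h => h.2, fun h => ⟨subset_closure (liftCurve_mem_hull t), h⟩⟩

theorem IsInspectionCurve.ne_zero_of_mem_frontier (hγ : IsInspectionCurve L γ) {x : E3}
    (hx : x ∈ frontier (convexHull ℝ (range γ))) : x ≠ 0 := by
  rintro rfl; exact hx.2 hγ.zero_mem_interior_hull

theorem IsInspectionCurve.exists_mem_frontier (hγ : IsInspectionCurve L γ) :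
    ∃ q : ℝ, liftCurve L γ q ∈ frontier (convexHull ℝ (range γ)) := by
  obtain ⟨x, hx⟩ := hγ.isCompact_hull.extremePoints_nonempty ⟨_, liftCurve_mem_hull 0⟩
  have hx' := extremePoints_convexHull_subset hx
  rw [← range_liftCurve] at hx'
  obtain ⟨q, rfl⟩ := hx'
  exact ⟨q, mem_frontier_hull_iff.2 fun h =>
    (disjoint_interior_extremePoints _).le_bot ⟨h, hx⟩⟩

/-- An arc of a minimal inspection curve in the interior of the hull is as long as its chord. -/
theorem IsMinInspectionCurve.dist_eq_of_Ioo (hγ : IsMinInspectionCurve L γ) {c d : ℝ}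
    (hcd : c ≤ d) (hdc : d < c + L)
    (hint : ∀ s ∈ Ioo c d, liftCurve L γ s ∈ interior (convexHull ℝ (range γ))) :
    dist (liftCurve L γ c) (liftCurve L γ d) = d - c := by
  obtain ⟨hL, -, hlip, -, hsph⟩ := id hγ.1
  refine le_antisymm ?_ (hγ.sub_le_dist hdc ?_)
  · have := hlip.dist_le_mul c d
    rwa [NNReal.coe_one, one_mul, dist_comm c, Real.dist_eq, abs_of_nonneg (by linarith)] at this
  refine hsph.trans ?_
  rw [← closure_convexHull_extremePoints hγ.1.isCompact_hull (convex_convexHull ℝ _)]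
  refine closure_minimal (convexHull_mono ?_)
    (isCompact_convexHull_of_isCompact (isCompact_Icc.image hlip.continuous)).isClosed
  intro x hx
  have hx' := extremePoints_convexHull_subset hx
  rw [← range_liftCurve] at hx'
  obtain ⟨q, rfl⟩ := hx'
  obtain ⟨y, hy, hqy⟩ := (periodic_liftCurve L γ).exists_mem_Ico hL q c
  rw [hqy] at hx ⊢
  rcases le_or_gt d y with h | h
  · exact ⟨y, ⟨h, hy.2.le⟩, rfl⟩
  rcases hy.1.eq_or_lt with rfl | h'
  · exact ⟨c + L, ⟨by linarith, le_rfl⟩, periodic_liftCurve L γ c⟩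
  · exact ((disjoint_interior_extremePoints _).le_bot ⟨hint y ⟨h', h⟩, hx⟩).elim

end Hull

section Radial

variable {L : ℝ} {γ : AddCircle L → E3}

theorem IsInspectionCurve.smul_mem_interior_hull (hγ : IsInspectionCurve L γ) {x : E3} {r : ℝ}
    (hx : x ∈ convexHull ℝ (range γ)) (h0 : 0 < r) (h1 : r < 1) :
    r • x ∈ interior (convexHull ℝ (range γ)) :=
  (convex_convexHull ℝ _).openSegment_interior_self_subset_interior hγ.zero_mem_interior_hull hx
    ⟨1 - r, r, by linarith, h0, by ring, by simp⟩

/-- A line through the origin meets the hull in the segment between its two boundary points. -/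
theorem IsInspectionCurve.mem_segment (hγ : IsInspectionCurve L γ) {x y z : E3}
    (hx : x ∈ frontier (convexHull ℝ (range γ))) (hy : y ∈ frontier (convexHull ℝ (range γ)))
    (h0 : (0 : E3) ∈ segment ℝ x y) (hz : z ∈ convexHull ℝ (range γ))
    (hzx : z ∈ Submodule.span ℝ {x}) : z ∈ segment ℝ x y := by
  have hx0 := hγ.ne_zero_of_mem_frontier hx
  have hy0 := hγ.ne_zero_of_mem_frontier hy
  obtain ⟨p, q, hp, hq, hpq, h⟩ := h0
  obtain ⟨l, rfl⟩ := Submodule.mem_span_singleton.1 hzx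
  have hp : 0 < p := hp.lt_of_ne fun e => hy0 (by simpa [← e, show q = 1 by linarith] using h)
  have hq : 0 < q := hq.lt_of_ne fun e => hx0 (by simpa [← e, show p = 1 by linarith] using h)
  have hyx : y = (-(p / q)) • x := by
    have h' : q • y = -(p • x) := by rw [eq_neg_iff_add_eq_zero, add_comm]; exact h
    rw [← inv_smul_smul₀ hq.ne' y, h', smul_neg, smul_smul, neg_smul]
    congr 2; field_simp
  have hl1 : l ≤ 1 := by
    by_contra hl
    push Not at hl
    apply hx.2
    have := hγ.smul_mem_interior_hull hz (r := l⁻¹) (by positivity) (inv_lt_one_of_one_lt₀ hl)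
    rwa [smul_smul, inv_mul_cancel₀ (by positivity), one_smul] at this
  have hl2 : -(p / q) ≤ l := by
    by_contra hl
    push Not at hl
    have hpq0 : 0 < p / q := by positivity
    have hl0 : l < 0 := by linarith
    apply hy.2
    have := hγ.smul_mem_interior_hull hz (r := -(p / q) / l)
      (div_pos_of_neg_of_neg (by linarith) hl0) ((div_lt_one_of_neg hl0).2 hl)
    rwa [smul_smul, div_mul_cancel₀ _ hl0.ne, ← hyx] at this
  refine ⟨1 - (1 - l) * q, (1 - l) * q, ?_, mul_nonneg (by linarith) hq.le, by ring, ?_⟩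
  · rw [neg_le, le_div_iff₀ hq] at hl2; nlinarith
  · rw [hyx, smul_smul, ← add_smul]
    congr 1
    field_simp
    linear_combination (1 - l) * (-hpq)

theorem IsInspectionCurve.mem_interior_of_tangent (hγ : IsInspectionCurve L γ) {t u : ℝ} {v : E3}
    (hv : HasDerivAt (liftCurve L γ) v t) (h0 : liftCurve L γ t + u • v = 0) :
    liftCurve L γ t ∈ interior (convexHull ℝ (range γ)) := by
  by_contra hnot
  obtain ⟨φ, hφ⟩ := geometric_hahn_banach_open_point
    (convex_convexHull ℝ (range γ)).interior isOpen_interior hnot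
  have hpos := hφ 0 hγ.zero_mem_interior_hull
  have hle : ∀ s, φ (liftCurve L γ s) ≤ φ (liftCurve L γ t) := by
    intro s
    have hs : liftCurve L γ s ∈ closure (interior (convexHull ℝ (range γ))) := by
      rw [(convex_convexHull ℝ _).closure_interior_eq_closure_of_nonempty_interior
        ⟨0, hγ.zero_mem_interior_hull⟩]
      exact subset_closure (liftCurve_mem_hull s)
    exact closure_minimal (fun x hx => (hφ x hx).le)
      (isClosed_le φ.continuous continuous_const) hs
  have hmax : IsLocalMax (fun s => φ (liftCurve L γ s)) t := Filter.Eventually.of_forall hle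
  have hd : φ v = 0 := hmax.hasDerivAt_eq_zero (φ.hasFDerivAt.comp_hasDerivAt t hv)
  have := congrArg φ h0
  simp only [map_add, map_smul, hd, map_zero, smul_zero, add_zero] at this hpos
  exact hpos.ne' this

/-- `[a, b]` is the closure of a maximal interval mapped into the interior of the hull, and this
interval is mapped into a line through the origin. -/
def IsRadialArc (L : ℝ) (γ : AddCircle L → E3) (a b : ℝ) : Prop :=
  2 ≤ b - a ∧ liftCurve L γ a ∈ frontier (convexHull ℝ (range γ)) ∧
    liftCurve L γ b ∈ frontier (convexHull ℝ (range γ)) ∧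
    (∀ s ∈ Ioo a b, liftCurve L γ s ∈ interior (convexHull ℝ (range γ))) ∧
    (0 : E3) ∈ segment ℝ (liftCurve L γ a) (liftCurve L γ b) ∧
    ∀ s ∈ Icc a b, liftCurve L γ s ∈ Submodule.span ℝ {liftCurve L γ a}

/-- Every parameter mapped into the interior of the hull lies in a maximal such interval. -/
theorem IsInspectionCurve.exists_component (hγ : IsInspectionCurve L γ) {t : ℝ}
    (ht : liftCurve L γ t ∈ interior (convexHull ℝ (range γ))) :
    ∃ a b, a < t ∧ t < b ∧ b ≤ a + L ∧
      liftCurve L γ a ∈ frontier (convexHull ℝ (range γ)) ∧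
      liftCurve L γ b ∈ frontier (convexHull ℝ (range γ)) ∧
      ∀ s ∈ Ioo a b, liftCurve L γ s ∈ interior (convexHull ℝ (range γ)) := by
  have hL := hγ.1
  have hcont := hγ.2.2.1.continuous
  have hper := periodic_liftCurve L γ
  set F := {s | liftCurve L γ s ∉ interior (convexHull ℝ (range γ))} with hF
  have hclosed : IsClosed F := (isOpen_interior.preimage hcont).isClosed_compl
  obtain ⟨q, hq⟩ := hγ.exists_mem_frontier
  have hA : (F ∩ Iic t).Nonempty := by
    obtain ⟨y, hy, hqy⟩ := hper.exists_mem_Ico hL q (t - L)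
    exact ⟨y, mem_frontier_hull_iff.1 (hqy ▸ hq), by simpa using hy.2.le⟩
  have hB : (F ∩ Ici t).Nonempty := by
    obtain ⟨y, hy, hqy⟩ := hper.exists_mem_Ico hL q t
    exact ⟨y, mem_frontier_hull_iff.1 (hqy ▸ hq), hy.1⟩
  have hAb : BddAbove (F ∩ Iic t) := ⟨t, fun _ h => h.2⟩
  have hBb : BddBelow (F ∩ Ici t) := ⟨t, fun _ h => h.2⟩
  have ha := (hclosed.inter isClosed_Iic).csSup_mem hA hAb
  have hb := (hclosed.inter isClosed_Ici).csInf_mem hB hBb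
  set a := sSup (F ∩ Iic t)
  set b := sInf (F ∩ Ici t)
  have hat : a < t := lt_of_le_of_ne ha.2 fun e => ha.1 (e ▸ ht)
  have htb : t < b := lt_of_le_of_ne hb.2 fun e => hb.1 (e ▸ ht)
  have haL : a + L ∈ F := by
    have := ha.1
    rwa [hF, mem_ofPred_eq, ← hper a] at this
  refine ⟨a, b, hat, htb, ?_, mem_frontier_hull_iff.2 ha.1, mem_frontier_hull_iff.2 hb.1, ?_⟩
  · refine csInf_le hBb ⟨haL, ?_⟩
    by_contra h
    rw [mem_Ici, not_le] at h
    have := le_csSup hAb ⟨haL, h.le⟩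
    linarith
  · intro s hs
    by_contra h
    rcases le_total s t with h' | h'
    · exact (le_csSup hAb ⟨h, h'⟩).not_gt hs.1
    · exact (csInf_le hBb ⟨h, h'⟩).not_gt hs.2

/-- A minimal inspection curve is straight on arcs in the interior of the hull. -/
theorem IsMinInspectionCurve.eq_add_smul (hγ : IsMinInspectionCurve L γ) {a b : ℝ}
    (hab : a < b) (hbL : b ≤ a + L)
    (hint : ∀ s ∈ Ioo a b, liftCurve L γ s ∈ interior (convexHull ℝ (range γ))) :
    ∃ e : E3, ‖e‖ = 1 ∧ ∀ s ∈ Icc a b, liftCurve L γ s = liftCurve L γ a + (s - a) • e := by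
  have hL := hγ.1.1
  have hper := periodic_liftCurve L γ
  have hdist : ∀ s ∈ Icc a b, ∀ s' ∈ Icc a b, s ≤ s' → s' < s + L →
      dist (liftCurve L γ s) (liftCurve L γ s') = s' - s := fun s hs s' hs' h h' =>
    hγ.dist_eq_of_Ioo h h' fun r hr => hint r ⟨hs.1.trans_lt hr.1, hr.2.trans_le hs'.2⟩
  have hbL' : b < a + L := by
    refine hbL.lt_of_ne fun e => ?_
    have h1 := hdist a ⟨le_rfl, hab.le⟩ (a + L * (3 / 4)) ⟨by linarith, by linarith⟩
      (by linarith) (by linarith)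
    have h2 := hdist (a + L * (3 / 4)) ⟨by linarith, by linarith⟩ b ⟨hab.le, le_rfl⟩
      (by linarith) (by linarith)
    rw [e, hper a, dist_comm] at h2
    linarith
  have hD := hdist a ⟨le_rfl, hab.le⟩ b ⟨hab.le, le_rfl⟩ hab.le hbL'
  have hba : 0 < b - a := by linarith
  refine ⟨(b - a)⁻¹ • (liftCurve L γ b - liftCurve L γ a), ?_, fun s hs => ?_⟩
  · rw [norm_smul, ← dist_eq_norm, dist_comm, hD, norm_inv, Real.norm_of_nonneg hba.le,
      inv_mul_cancel₀ hba.ne']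
  · have h1 := hdist a ⟨le_rfl, hab.le⟩ s hs hs.1 (by linarith [hs.2])
    have h2 := hdist s hs b ⟨hab.le, le_rfl⟩ hs.2 (by linarith [hs.1])
    obtain ⟨r, hr, hrs⟩ := dist_add_dist_eq_iff.1
      (show dist (liftCurve L γ a) (liftCurve L γ s) + dist (liftCurve L γ s) (liftCurve L γ b) =
        dist (liftCurve L γ a) (liftCurve L γ b) by rw [h1, h2, hD]; ring)
    rw [← hrs, dist_left_lineMap, hD, Real.norm_of_nonneg hr.1] at h1
    rw [← hrs, AffineMap.lineMap_apply_module', smul_smul, add_comm, ← h1, mul_assoc,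
      mul_inv_cancel₀ hba.ne', mul_one]

theorem IsMinInspectionCurve.exists_isRadialArc (hγ : IsMinInspectionCurve L γ) {t u : ℝ} {v : E3}
    (hv : HasDerivAt (liftCurve L γ) v t) (h0 : liftCurve L γ t + u • v = 0) :
    ∃ a b, t ∈ Icc a b ∧ IsRadialArc L γ a b := by
  obtain ⟨a, b, hat, htb, hbL, ha, hb, hint⟩ :=
    hγ.1.exists_component (hγ.1.mem_interior_of_tangent hv h0)
  obtain ⟨e, he, hlin⟩ := hγ.eq_add_smul (hat.trans htb) hbL hint
  have hve : v = e := by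
    refine hv.unique (HasDerivAt.congr_of_eventuallyEq
      (f := fun s => liftCurve L γ a + (s - a) • e) ?_ ?_)
    · simpa using (((hasDerivAt_id t).sub_const a).smul_const e).const_add (liftCurve L γ a)
    · filter_upwards [Icc_mem_nhds hat htb] with s hs using hlin s hs
  subst hve
  set α := a - t - u with hα
  have hfa : liftCurve L γ a = α • v := by
    rw [hlin t ⟨hat.le, htb.le⟩, add_assoc, ← add_smul] at h0
    rw [eq_neg_of_add_eq_zero_left h0, ← neg_smul]
    congr 1; ring
  have hf : ∀ s ∈ Icc a b, liftCurve L γ s = (α + (s - a)) • v := fun s hs => by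
    rw [hlin s hs, hfa, add_smul]
  have hab := hat.trans htb
  have hfb := hf b ⟨hab.le, le_rfl⟩
  set β := α + (b - a) with hβ
  have hnorm : ∀ {r : ℝ}, r • v ∈ frontier (convexHull ℝ (range γ)) → 1 ≤ |r| := by
    intro r hr
    by_contra h
    refine hr.2 (hγ.1.ball_subset_interior_hull ?_)
    rw [mem_ball_zero_iff, norm_smul, he, mul_one]
    exact not_le.1 h
  have hα1 := hnorm (hfa ▸ ha)
  have hβ1 := hnorm (hfb ▸ hb)
  have hα0 : α ≤ 0 := by
    by_contra h
    push Not at h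
    have hβ0 : 0 < β := by linarith
    have := hγ.1.smul_mem_interior_hull (liftCurve_mem_hull (γ := γ) b) (r := α / β)
      (by positivity) ((div_lt_one hβ0).2 (by linarith))
    rw [hfb, smul_smul, div_mul_cancel₀ _ hβ0.ne', ← hfa] at this
    exact ha.2 this
  have hβ0 : 0 ≤ β := by
    by_contra h
    push Not at h
    have hα0 : α < 0 := by linarith
    have := hγ.1.smul_mem_interior_hull (liftCurve_mem_hull (γ := γ) a) (r := β / α)
      (div_pos_of_neg_of_neg h hα0) ((div_lt_one_of_neg hα0).2 (by linarith))
    rw [hfa, smul_smul, div_mul_cancel₀ _ hα0.ne, ← hfb] at this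
    exact hb.2 this
  rw [abs_of_nonpos hα0] at hα1
  rw [abs_of_nonneg hβ0] at hβ1
  have hαβ : 0 < β - α := by linarith
  refine ⟨a, b, ⟨hat.le, htb.le⟩, by linarith, ha, hb, hint, ?_, fun s hs => ?_⟩
  · refine ⟨β / (β - α), -α / (β - α), by positivity, div_nonneg (by linarith) hαβ.le, ?_, ?_⟩
    · field_simp; ring
    · rw [hfa, hfb, smul_smul, smul_smul, ← add_smul]
      convert zero_smul ℝ v
      field_simp; ring
  · rw [Submodule.mem_span_singleton]
    refine ⟨(α + (s - a)) / α, ?_⟩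
    rw [hfa, smul_smul, div_mul_cancel₀ _ (by linarith), hf s hs]

end Radial

/-- Finitely many non-overlapping closed intervals can be merged into pairwise disjoint ones,
preserving any property that passes to the union of two adjacent intervals. -/
theorem exists_finset_disjoint_Icc {P : ℝ → ℝ → Prop}
    (hP : ∀ a b c, P a b → P b c → P a c) (S : Finset (ℝ × ℝ))
    (hS : ∀ r ∈ S, r.1 < r.2 ∧ P r.1 r.2)
    (hsep : ∀ r ∈ S, ∀ r' ∈ S, r ≠ r' → r.2 ≤ r'.1 ∨ r'.2 ≤ r.1) :
    ∃ S' : Finset (ℝ × ℝ), (∀ r ∈ S', r.1 < r.2 ∧ P r.1 r.2) ∧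
      (∀ r ∈ S', ∀ r' ∈ S', r ≠ r' → r.2 < r'.1 ∨ r'.2 < r.1) ∧
      ∀ t, (∃ r ∈ S', t ∈ Icc r.1 r.2) ↔ ∃ r ∈ S, t ∈ Icc r.1 r.2 := by
  classical
  induction hn : S.card using Nat.strong_induction_on generalizing S with
  | _ n ih =>
  subst hn
  by_cases hadj : ∃ p ∈ S, ∃ q ∈ S, p ≠ q ∧ p.2 = q.1
  · obtain ⟨p, hp, q, hq, hpq, hpq'⟩ := hadj
    have hp' := hS p hp
    have hq' := hS q hq
    have hmem : ∀ r, r ∈ insert (p.1, q.2) ((S.erase p).erase q) ↔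
        r = (p.1, q.2) ∨ (r ≠ q ∧ r ≠ p ∧ r ∈ S) := by
      intro r; simp [Finset.mem_erase]
    have hqe : q ∈ S.erase p := Finset.mem_erase.2 ⟨hpq.symm, hq⟩
    have hcard : (insert (p.1, q.2) ((S.erase p).erase q)).card < S.card := by
      have h1 := Finset.card_insert_le (p.1, q.2) ((S.erase p).erase q)
      have h2 := Finset.card_erase_lt_of_mem hqe
      have h3 := Finset.card_erase_lt_of_mem hp
      omega
    have hnew : ∀ r ∈ S, r ≠ q → r ≠ p → r.2 ≤ p.1 ∨ q.2 ≤ r.1 := by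
      intro r hr hrq hrp
      have h1 := (hS r hr).1
      rcases hsep r hr p hp hrp with h | h
      · exact Or.inl h
      · rcases hsep r hr q hq hrq with h' | h'
        · linarith
        · exact Or.inr h'
    obtain ⟨S', h1, h2, h3⟩ := ih _ hcard _ (by
        intro r hr
        rcases (hmem r).1 hr with rfl | ⟨-, -, hr⟩
        · exact ⟨by linarith [hp'.1, hq'.1], hP _ _ _ hp'.2 (hpq' ▸ hq'.2)⟩
        · exact hS r hr) (by
        intro r hr r' hr' hne
        rcases (hmem r).1 hr with rfl | ⟨hrq, hrp, hr⟩ <;>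
          rcases (hmem r').1 hr' with rfl | ⟨hrq', hrp', hr'⟩
        · exact (hne rfl).elim
        · exact (hnew r' hr' hrq' hrp').symm
        · exact hnew r hr hrq hrp
        · exact hsep r hr r' hr' hne) rfl
    refine ⟨S', h1, h2, fun t => (h3 t).trans ⟨?_, ?_⟩⟩
    · rintro ⟨r, hr, ht⟩
      rcases (hmem r).1 hr with rfl | ⟨-, -, hr⟩
      · rcases le_total t p.2 with h | h
        · exact ⟨p, hp, ht.1, h⟩
        · exact ⟨q, hq, hpq' ▸ h, ht.2⟩
      · exact ⟨r, hr, ht⟩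
    · rintro ⟨r, hr, ht⟩
      by_cases hrp : r = p
      · subst hrp
        exact ⟨(r.1, q.2), (hmem _).2 (Or.inl rfl), ht.1, by linarith [ht.2, hq'.1]⟩
      by_cases hrq : r = q
      · subst hrq
        exact ⟨(p.1, r.2), (hmem _).2 (Or.inl rfl), by linarith [ht.1, hp'.1], ht.2⟩
      · exact ⟨r, (hmem r).2 (Or.inr ⟨hrq, hrp, hr⟩), ht⟩
  · push Not at hadj
    refine ⟨S, hS, fun r hr r' hr' hne => ?_, fun t => Iff.rfl⟩
    exact (hsep r hr r' hr' hne).imp (fun h => h.lt_of_ne (hadj r hr r' hr' hne))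
      fun h => h.lt_of_ne (hadj r' hr' r hr hne.symm)

section RadialArcs

variable {L : ℝ} {γ : AddCircle L → E3} {a b c d : ℝ}

theorem IsRadialArc.not_mem_Ioo (h : IsRadialArc L γ a b) {q : ℝ}
    (hq : liftCurve L γ q ∈ frontier (convexHull ℝ (range γ))) : q ∉ Ioo a b :=
  fun hqab => hq.2 (h.2.2.2.1 q hqab)

theorem IsRadialArc.add_int_mul (h : IsRadialArc L γ a b) (n : ℤ) :
    IsRadialArc L γ (a + n * L) (b + n * L) := by
  have hper : ∀ s, liftCurve L γ (s + n * L) = liftCurve L γ s :=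
    (periodic_liftCurve L γ).int_mul n
  obtain ⟨h1, h2, h3, h4, h5, h6⟩ := h
  unfold IsRadialArc
  rw [hper, hper]
  refine ⟨by linarith, h2, h3, fun s hs => ?_, h5, fun s hs => ?_⟩
  · rw [← sub_add_cancel s (n * L), hper]
    exact h4 _ ⟨by linarith [hs.1], by linarith [hs.2]⟩
  · rw [← sub_add_cancel s (n * L), hper]
    exact h6 _ ⟨by linarith [hs.1], by linarith [hs.2]⟩

theorem IsRadialArc.separated (h : IsRadialArc L γ a b) (h' : IsRadialArc L γ c d)
    (hne : (a, b) ≠ (c, d)) : b ≤ c ∨ d ≤ a := by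
  by_contra hcon
  push Not at hcon
  have hab : a < b := by linarith [h.1]
  have hcd : c < d := by linarith [h'.1]
  apply hne
  have h1 := h.not_mem_Ioo h'.2.1
  have h2 := h.not_mem_Ioo h'.2.2.1
  have h3 := h'.not_mem_Ioo h.2.1
  have h4 := h'.not_mem_Ioo h.2.2.1
  simp only [mem_Ioo, not_and, not_lt] at h1 h2 h3 h4
  ext
  · apply le_antisymm <;> by_contra! hlt
    · linarith [h3 hlt]
    · linarith [h1 hlt]
  · apply le_antisymm <;> by_contra! hlt
    · linarith [h2 hcon.2]
    · linarith [h4 hcon.1]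

/-- The radial arcs within one period merge to finitely many disjoint intervals, each mapped into
a line through the origin. -/
theorem IsInspectionCurve.exists_finset_radial (hγ : IsInspectionCurve L γ) (p : ℝ) :
    ∃ S : Finset (ℝ × ℝ),
      (∀ r ∈ S, r.1 < r.2 ∧
        ∃ x ∈ frontier (convexHull ℝ (range γ)), ∃ y ∈ frontier (convexHull ℝ (range γ)),
          (0 : E3) ∈ segment ℝ x y ∧
          ∀ s ∈ Icc r.1 r.2, liftCurve L γ s ∈ Submodule.span ℝ {x}) ∧
      (∀ r ∈ S, ∀ r' ∈ S, r ≠ r' → r.2 < r'.1 ∨ r'.2 < r.1) ∧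
      ∀ t, (∃ r ∈ S, t ∈ Icc r.1 r.2) ↔
        ∃ a b, IsRadialArc L γ a b ∧ p ≤ a ∧ b ≤ p + L ∧ t ∈ Icc a b := by
  set A : Set (ℝ × ℝ) := {r | IsRadialArc L γ r.1 r.2 ∧ p ≤ r.1 ∧ r.2 ≤ p + L}
  have hfin : A.Finite := by
    refine Set.Finite.of_injOn (f := fun r : ℝ × ℝ => ⌊r.1⌋) (t := Icc ⌊p⌋ ⌊p + L⌋) ?_ ?_
      (Set.finite_Icc _ _)
    · intro r hr
      exact ⟨Int.floor_mono hr.2.1, Int.floor_mono (by linarith [hr.2.2, hr.1.1])⟩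
    · intro r hr r' hr' he
      by_contra hne
      have he' := Int.abs_sub_lt_one_of_floor_eq_floor he
      rw [abs_lt] at he'
      rcases hr.1.separated hr'.1 hne with h | h
      · linarith [hr.1.1]
      · linarith [hr'.1.1]
  let P : ℝ → ℝ → Prop := fun a b =>
    a < b ∧ liftCurve L γ a ≠ 0 ∧ liftCurve L γ b ≠ 0 ∧
      ∃ x ∈ frontier (convexHull ℝ (range γ)), ∃ y ∈ frontier (convexHull ℝ (range γ)),
        (0 : E3) ∈ segment ℝ x y ∧
        ∀ s ∈ Icc a b, liftCurve L γ s ∈ Submodule.span ℝ {x}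
  obtain ⟨S, h1, h2, h3⟩ := exists_finset_disjoint_Icc (P := P) (by
      rintro a b c ⟨hab, ha, hb, x, hx, y, hy, h0, h⟩ ⟨hbc, -, hc, x', -, y', -, -, h'⟩
      refine ⟨hab.trans hbc, ha, hc, x, hx, y, hy, h0, fun s hs => ?_⟩
      rcases le_total s b with hsb | hsb
      · exact h s ⟨hs.1, hsb⟩
      have hb' := h' b ⟨le_rfl, hbc.le⟩
      obtain ⟨k, hk⟩ := Submodule.mem_span_singleton.1 hb'
      obtain ⟨l, hl⟩ := Submodule.mem_span_singleton.1 (h' s ⟨hsb, hs.2⟩)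
      have hk0 : k ≠ 0 := by rintro rfl; exact hb (by simpa using hk.symm)
      have : liftCurve L γ s = (l * k⁻¹) • liftCurve L γ b := by
        rw [← hk, smul_smul, mul_assoc, inv_mul_cancel₀ hk0, mul_one, hl]
      rw [this]
      exact Submodule.smul_mem _ _ (h b ⟨hab.le, le_rfl⟩)) hfin.toFinset (by
      intro r hr
      obtain ⟨hr, -⟩ := hfin.mem_toFinset.1 hr
      have hlt : r.1 < r.2 := by linarith [hr.1]
      exact ⟨hlt, hlt, hγ.ne_zero_of_mem_frontier hr.2.1, hγ.ne_zero_of_mem_frontier hr.2.2.1,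
        _, hr.2.1, _, hr.2.2.1, hr.2.2.2.2.1, hr.2.2.2.2.2⟩) (by
      intro r hr r' hr' hne
      exact (hfin.mem_toFinset.1 hr).1.separated (hfin.mem_toFinset.1 hr').1 hne)
  refine ⟨S, fun r hr => ⟨(h1 r hr).1, (h1 r hr).2.2.2.2⟩, h2, fun t => (h3 t).trans ⟨?_, ?_⟩⟩
  · rintro ⟨r, hr, ht⟩
    obtain ⟨hr, h, h'⟩ := hfin.mem_toFinset.1 hr
    exact ⟨r.1, r.2, hr, h, h', ht⟩
  · rintro ⟨a, b, hr, h, h', ht⟩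
    exact ⟨(a, b), hfin.mem_toFinset.2 ⟨hr, h, h'⟩, ht⟩

theorem IsInspectionCurve.not_subset_span (hγ : IsInspectionCurve L γ) (x : E3) (q : ℝ) :
    ¬ ∀ s ∈ Icc q (q + L), liftCurve L γ s ∈ Submodule.span ℝ {x} := by
  intro h
  have hsub : convexHull ℝ (range γ) ⊆ (Submodule.span ℝ {x} : Set E3) := by
    refine convexHull_min ?_ (Submodule.convex _)
    rw [← range_liftCurve]
    rintro _ ⟨s, rfl⟩
    obtain ⟨y, hy, hsy⟩ := (periodic_liftCurve L γ).exists_mem_Ico hγ.1 s q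
    rw [hsy]
    exact h y ⟨hy.1, hy.2.le⟩
  have htop := Submodule.eq_top_of_nonempty_interior' (Submodule.span ℝ {x})
    ⟨0, interior_mono hsub hγ.zero_mem_interior_hull⟩
  have h1 := finrank_span_le_card (R := ℝ) ({x} : Set E3)
  rw [htop, finrank_top, finrank_euclideanSpace_fin, Set.toFinset_singleton, Finset.card_singleton] at h1
  omega

/-- The radial arcs do not cover the whole circle. -/
theorem IsInspectionCurve.exists_not_mem_radial (hγ : IsInspectionCurve L γ) :
    ∃ p, ∀ a b, IsRadialArc L γ a b → p ∉ Icc a b := by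
  by_contra! hcov
  have hL := hγ.1
  obtain ⟨q, hq⟩ := hγ.exists_mem_frontier
  obtain ⟨S, h1, h2, h3⟩ := hγ.exists_finset_radial q
  have hq' : liftCurve L γ (q + L) ∈ frontier (convexHull ℝ (range γ)) := by
    rwa [periodic_liftCurve L γ q]
  have hclosed : ∀ S' : Finset (ℝ × ℝ), IsClosed (⋃ r ∈ S', Icc r.1 r.2) := fun S' =>
    isClosed_biUnion_finset fun r _ => isClosed_Icc
  have hsub : Icc q (q + L) ⊆ ⋃ r ∈ S, Icc r.1 r.2 := by
    rw [← closure_Ioo (by linarith : q ≠ q + L)]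
    refine closure_minimal (fun t ht => ?_) (hclosed S)
    obtain ⟨a, b, hab, hta⟩ := hcov t
    have hqa := hab.not_mem_Ioo hq
    have hqb := hab.not_mem_Ioo hq'
    simp only [mem_Ioo, not_and, not_lt] at hqa hqb
    have := (h3 t).2 ⟨a, b, hab, by
      by_contra! h; linarith [hqa h, ht.1, hta.2], hqb (by linarith [hta.1, ht.2]), hta⟩
    simpa only [mem_iUnion, exists_prop] using this
  obtain ⟨r, hr, hqr⟩ : ∃ r ∈ S, q ∈ Icc r.1 r.2 := by
    simpa only [mem_iUnion, exists_prop] using hsub ⟨le_rfl, by linarith⟩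
  have hdisj : ∀ t ∈ Icc r.1 r.2, t ∉ ⋃ r' ∈ S.erase r, Icc r'.1 r'.2 := by
    intro t ht ht'
    simp only [mem_iUnion, exists_prop, Finset.mem_erase] at ht'
    obtain ⟨r', ⟨hne, hr'⟩, ht'⟩ := ht'
    rcases h2 r hr r' hr' hne.symm with h | h
    · linarith [ht.2, ht'.1]
    · linarith [ht.1, ht'.2]
  have hsub' : Icc q (q + L) ⊆ Icc r.1 r.2 ∪ ⋃ r' ∈ S.erase r, Icc r'.1 r'.2 := by
    intro t ht
    obtain ⟨r', hr', ht'⟩ : ∃ r ∈ S, t ∈ Icc r.1 r.2 := by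
      simpa only [mem_iUnion, exists_prop] using hsub ht
    by_cases he : r' = r
    · exact Or.inl (he ▸ ht')
    · refine Or.inr ?_
      simp only [mem_iUnion, exists_prop]
      exact ⟨r', Finset.mem_erase.2 ⟨he, hr'⟩, ht'⟩
  rcases isPreconnected_iff_subset_of_disjoint_closed.1 (isPreconnected_Icc) _ _ isClosed_Icc
    (hclosed (S.erase r)) hsub' (by
      ext t; simp only [mem_inter_iff, mem_empty_iff_false, iff_false]
      exact fun h => hdisj t h.2.1 h.2.2) with h | h
  · obtain ⟨-, x, -, y, -, -, hx⟩ := h1 r hr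
    exact hγ.not_subset_span x q fun s hs => hx s (h hs)
  · exact hdisj q hqr (h ⟨le_rfl, by linarith⟩)

end RadialArcs

/-- For a minimal inspection curve `γ : ℝ/L → ℝ³` there is an open set
`U ⊆ ℝ/L` such that at every regular point of `γ` in `U` the tangent line avoids the
origin; and if `U ≠ ℝ/L`, then the complement of `U` is the disjoint union of finitely
many closed intervals (images in `ℝ/L` of closed intervals of `ℝ` of length `< L`),
each mapped by `γ` into a line segment passing through the origin with endpoints on the
boundary of the convex hull of `γ`. -/
theorem minimal_inspection_tangent_lines_avoid_origin
    (L : ℝ) (γ : AddCircle L → E3) (hγ : IsMinInspectionCurve L γ) :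
    ∃ U : Set (AddCircle L), IsOpen U ∧
      (∀ t : ℝ, (t : AddCircle L) ∈ U → ∀ v : E3,
        HasDerivAt (liftCurve L γ) v t → v ≠ 0 →
          ∀ u : ℝ, liftCurve L γ t + u • v ≠ 0) ∧
      (U ≠ Set.univ →
        ∃ (m : ℕ) (a b : Fin m → ℝ),
          (∀ i, a i ≤ b i ∧ b i - a i < L) ∧
          Uᶜ = ⋃ i, (fun s : ℝ => (s : AddCircle L)) '' Set.Icc (a i) (b i) ∧
          Pairwise (Function.onFun Disjoint
            fun i => (fun s : ℝ => (s : AddCircle L)) '' Set.Icc (a i) (b i)) ∧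
          ∀ i, ∃ x y : E3,
            x ∈ frontier (convexHull ℝ (Set.range γ)) ∧
            y ∈ frontier (convexHull ℝ (Set.range γ)) ∧
            (0 : E3) ∈ segment ℝ x y ∧
            γ '' ((fun s : ℝ => (s : AddCircle L)) '' Set.Icc (a i) (b i)) ⊆
              segment ℝ x y) := by
  have hL := hγ.1.1
  have : Fact (0 < L) := ⟨hL⟩
  obtain ⟨p, hp⟩ := hγ.1.exists_not_mem_radial
  have hpL : ∀ a b, IsRadialArc L γ a b → p + L ∉ Icc a b := fun a b hab h => by
    refine hp _ _ (hab.add_int_mul (-1)) ⟨?_, ?_⟩ <;> push_cast <;> linarith [h.1, h.2]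
  obtain ⟨S, hS, hdisj, hcov⟩ := hγ.1.exists_finset_radial p
  have hbds : ∀ r ∈ S, ∀ s ∈ Icc r.1 r.2, s ∈ Ioo p (p + L) := by
    intro r hr s hs
    obtain ⟨a, b, hab, hpa, hbp, hs⟩ := (hcov s).1 ⟨r, hr, hs⟩
    refine ⟨(hpa.trans hs.1).lt_of_ne ?_, (hs.2.trans hbp).lt_of_ne ?_⟩
    · rintro rfl; exact hp a b hab hs
    · rintro rfl; exact hpL a b hab hs
  let C : Set (AddCircle L) := ⋃ r ∈ S, (fun s : ℝ => (s : AddCircle L)) '' Icc r.1 r.2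
  have hC : IsClosed C := isClosed_biUnion_finset fun r _ =>
    (isCompact_Icc.image (AddCircle.continuous_mk' L)).isClosed
  refine ⟨Cᶜ, hC.isOpen_compl, fun t ht v hv _ u h0 => ht ?_, fun _ => ?_⟩
  · obtain ⟨a, b, htab, hab⟩ := hγ.exists_isRadialArc hv h0
    obtain ⟨n, hn, -⟩ := existsUnique_add_zsmul_mem_Ico hL t p
    rw [zsmul_eq_mul] at hn
    have hab' := hab.add_int_mul n
    have ht' : t + n * L ∈ Icc (a + n * L) (b + n * L) :=
      ⟨by linarith [htab.1], by linarith [htab.2]⟩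
    obtain ⟨r, hr, hrt⟩ := (hcov (t + n * L)).2 ⟨_, _, hab', by
      by_contra! h; exact hp _ _ hab' ⟨h.le, hn.1.trans ht'.2⟩, by
      by_contra! h; exact hpL _ _ hab' ⟨ht'.1.trans hn.2.le, h.le⟩, ht'⟩
    simp only [C, mem_iUnion, exists_prop]
    refine ⟨r, hr, t + n * L, hrt, ?_⟩
    have : ((n * L : ℝ) : AddCircle L) = 0 :=
      AddCircle.coe_eq_zero_iff L |>.2 ⟨n, by simp⟩
    simp only [AddCircle.coe_add, this, add_zero]
  · let e := S.equivFin.symm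
    refine ⟨S.card, fun i => (e i).1.1, fun i => (e i).1.2, fun i => ?_, ?_, ?_, fun i => ?_⟩
    · have hr := (e i).2
      have hlt := (hS _ hr).1
      have h1 := hbds _ hr _ ⟨le_rfl, hlt.le⟩
      have h2 := hbds _ hr _ ⟨hlt.le, le_rfl⟩
      exact ⟨hlt.le, by linarith [h1.1, h2.2]⟩
    · rw [compl_compl]
      ext z
      simp only [C, mem_iUnion, exists_prop]
      constructor
      · rintro ⟨r, hr, hz⟩
        exact ⟨e.symm ⟨r, hr⟩, by simpa using hz⟩
      · rintro ⟨i, hz⟩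
        exact ⟨_, (e i).2, hz⟩
    · intro i j hij
      rw [Function.onFun, Set.disjoint_left]
      rintro _ ⟨s, hs, rfl⟩ ⟨s', hs', he⟩
      have hs1 := hbds _ (e i).2 s hs
      have hs2 := hbds _ (e j).2 s' hs'
      have he' : s' = s := (AddCircle.coe_eq_coe_iff_of_mem_Ico
        (Ioo_subset_Ico_self hs2) (Ioo_subset_Ico_self hs1)).1 he
      subst he'
      rcases hdisj _ (e i).2 _ (e j).2 (fun h => hij (e.injective (Subtype.ext h))) with h | h
      · linarith [hs.2, hs'.1]
      · linarith [hs.1, hs'.2]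
    · obtain ⟨-, x, hx, y, hy, h0, hspan⟩ := hS _ (e i).2
      refine ⟨x, y, hx, hy, h0, ?_⟩
      rintro _ ⟨_, ⟨s, hs, rfl⟩, rfl⟩
      exact hγ.1.mem_segment hx hy h0 (liftCurve_mem_hull s) (hspan s hs)
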